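/- Let P : g → g be ad-equivariant and homogeneous of degree m ≥ 1, and let h, e ∈ g satisfy [h, e] = 2e. If P(e) ≠ 0, then the m+1 vectors dᵏP(h).e⁽ᵏ⁾ for k = 0, 1, …, m are linearly independent in g. -/

import Mathlib

section

variable {𝕜 E F : Type*} [NontriviallyNormedField 𝕜] [NormedAddCommGroup E] [NormedSpace 𝕜 E]
  [NormedAddCommGroup F] [NormedSpace 𝕜 F]

/-- The derivatives of `f` along the line `t ↦ x + t • v`. -/
theorem iteratedDeriv_comp_add_smul {f : E → F} {k : ℕ} (hf : ContDiff 𝕜 k f) (x v : E) (t : 𝕜) :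
    iteratedDeriv k (fun s : 𝕜 => f (x + s • v)) t
      = iteratedFDeriv 𝕜 k f (x + t • v) (fun _ => v) := by
  have hshift : ContDiff 𝕜 k (fun z => f (x + z)) := hf.comp (contDiff_const.add contDiff_id)
  have hcomp := (ContinuousLinearMap.toSpanSingleton 𝕜 v).iteratedFDeriv_comp_right hshift t le_rfl
  rw [iteratedFDeriv_comp_add_left] at hcomp
  simpa [iteratedDeriv_eq_iteratedFDeriv, Function.comp_def] using
    congrArg (fun M => M fun _ => (1 : 𝕜)) hcomp

/-- The derivative of order `m` of a homogeneous map of degree `m` is constant. -/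
theorem iteratedFDeriv_eq_of_homogeneous {f : E → F} {m : ℕ} (hf : ContDiff 𝕜 m f)
    (hhom : ∀ (t : 𝕜) (x : E), f (t • x) = t ^ m • f x) (x : E) :
    iteratedFDeriv 𝕜 m f x = iteratedFDeriv 𝕜 m f 0 := by
  have hscale : ∀ a : 𝕜, a ≠ 0 → iteratedFDeriv 𝕜 m f (a • x) = iteratedFDeriv 𝕜 m f x := by
    intro a ha
    have hcomp := congrFun (iteratedFDeriv_comp_const_smul a hf) x
    simp only [hhom a] at hcomp
    rw [iteratedFDeriv_const_smul_apply' hf.contDiffAt] at hcomp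
    exact (smul_right_injective _ (pow_ne_zero m ha) hcomp).symm
  have hcont : Continuous fun a : 𝕜 => iteratedFDeriv 𝕜 m f (a • x) :=
    (hf.continuous_iteratedFDeriv le_rfl).comp (continuous_id.smul continuous_const)
  have hlim := (hcont.tendsto 0).mono_left (nhdsWithin_le_nhds (s := {0}ᶜ))
  rw [zero_smul] at hlim
  refine tendsto_nhds_unique (Filter.Tendsto.congr' ?_ tendsto_const_nhds) hlim
  filter_upwards [self_mem_nhdsWithin] with a ha
  exact (hscale a ha).symm

/-- The derivative of order `m` of a homogeneous map of degree `m`, on the diagonal. -/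
theorem iteratedFDeriv_apply_const_of_homogeneous {f : E → F} {m : ℕ} (hf : ContDiff 𝕜 m f)
    (hhom : ∀ (t : 𝕜) (x : E), f (t • x) = t ^ m • f x) (x v : E) :
    iteratedFDeriv 𝕜 m f x (fun _ => v) = (m.factorial : 𝕜) • f v := by
  have hline := iteratedDeriv_comp_add_smul hf 0 v (0 : 𝕜)
  simp only [zero_add, zero_smul, hhom _ v] at hline
  rw [iteratedFDeriv_eq_of_homogeneous hf hhom x, ← hline]
  have hpow := (ContinuousLinearMap.toSpanSingleton 𝕜 (f v)).iteratedFDeriv_comp_left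
    (f := fun s : 𝕜 => s ^ m) (x := 0) (n := m) (contDiff_id.pow m).contDiffAt le_rfl
  have hfact := iteratedDeriv_fun_pow_zero (𝕜 := 𝕜) (n := m) (m := m)
  rw [iteratedDeriv_eq_iteratedFDeriv] at hfact
  have happ := congrArg (fun M => M fun _ => (1 : 𝕜)) hpow
  simpa [iteratedDeriv_eq_iteratedFDeriv, Function.comp_def, hfact] using happ

/-- Differentiating the linear differential equation `L f = c f'`. -/
theorem map_iteratedDeriv_eq_smul_succ {f : 𝕜 → E} (hf : ContDiff 𝕜 ⊤ f) (L : E →L[𝕜] E) (c : 𝕜)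
    (hL : ∀ t, L (f t) = c • deriv f t) (k : ℕ) (t : 𝕜) :
    L (iteratedDeriv k f t) = c • iteratedDeriv (k + 1) f t := by
  have hdiff : ∀ n, Differentiable 𝕜 (iteratedDeriv n f) := fun n =>
    hf.differentiable_iteratedDeriv n (by exact WithTop.coe_lt_top _)
  induction k generalizing t with
  | zero => simpa [iteratedDeriv_one] using hL t
  | succ k ih =>
    have hd := (L.hasFDerivAt.comp_hasDerivAt t (hdiff k t).hasDerivAt).deriv
    have hfun : L ∘ iteratedDeriv k f = fun s => c • iteratedDeriv (k + 1) f s := funext ih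
    rw [hfun, deriv_fun_const_smul c (hdiff (k + 1) t)] at hd
    rw [iteratedDeriv_succ, iteratedDeriv_succ (n := k + 1), ← hd]

/-- Differentiating the Euler equation `L f = c t f'`. -/
theorem map_iteratedDeriv_eq_of_euler {f : 𝕜 → E} (hf : ContDiff 𝕜 ⊤ f) (L : E →L[𝕜] E) (c : 𝕜)
    (hL : ∀ t, L (f t) = (c * t) • deriv f t) (k : ℕ) (t : 𝕜) :
    L (iteratedDeriv k f t)
      = (c * t) • iteratedDeriv (k + 1) f t + (c * k) • iteratedDeriv k f t := by
  have hdiff : ∀ n, Differentiable 𝕜 (iteratedDeriv n f) := fun n =>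
    hf.differentiable_iteratedDeriv n (by exact WithTop.coe_lt_top _)
  induction k generalizing t with
  | zero => simpa [iteratedDeriv_one] using hL t
  | succ k ih =>
    have hd := (L.hasFDerivAt.comp_hasDerivAt t (hdiff k t).hasDerivAt).deriv
    have hfun : L ∘ iteratedDeriv k f = fun s =>
      (c * s) • iteratedDeriv (k + 1) f s + (c * k) • iteratedDeriv k f s := funext ih
    have hrhs := ((((hasDerivAt_id t).const_mul c).smul (hdiff (k + 1) t).hasDerivAt).add
      ((hdiff k t).hasDerivAt.const_smul (c * k))).deriv
    rw [iteratedDeriv_succ, ← hd, hfun]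
    refine hrhs.trans ?_
    simp only [← iteratedDeriv_succ, id, Nat.cast_succ]
    module

end

theorem stmt {g : Type*} [NormedAddCommGroup g] [NormedSpace ℂ g] [FiniteDimensional ℂ g]
    -- `lie` is the Lie bracket of the finite-dimensional complex Lie algebra `g`,
    -- given as bilinear data so that it is compatible with the normed space structure.
    (lie : g →ₗ[ℂ] g →ₗ[ℂ] g)
    (lie_self : ∀ x : g, lie x x = 0)
    (lie_jacobi : ∀ x y z : g, lie x (lie y z) = lie (lie x y) z + lie y (lie x z))
    (P : g → g) (hP : ContDiff ℂ ⊤ P)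
    (hPeq : ∀ x y : g, fderiv ℂ P x (lie y x) = lie y (P x))
    (m : ℕ) (hm : 1 ≤ m)
    (hhom : ∀ (t : ℂ) (x : g), P (t • x) = t ^ m • P x)
    (h e : g) (hhe : lie h e = (2 : ℂ) • e)
    (hne : P e ≠ 0) :
    LinearIndependent ℂ (fun k : Fin (m + 1) => iteratedFDeriv ℂ (k : ℕ) P h (fun _ => e)) := by
  have hskew : ∀ x y : g, lie x y = -lie y x := by
    intro x y
    have hadd := lie_self (x + y)
    simp only [map_add, LinearMap.add_apply, lie_self, zero_add, add_zero] at hadd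
    exact eq_neg_of_add_eq_zero_right hadd
  have hPk : ∀ k : ℕ, ContDiff ℂ k P := fun k => hP.of_le le_top
  set f : ℂ → g := fun t => P (h + t • e) with hf_def
  have hf : ContDiff ℂ ⊤ f := hP.comp (contDiff_const.add (contDiff_id.smul contDiff_const))
  have hderiv : ∀ t, deriv f t = fderiv ℂ P (h + t • e) e := by
    intro t
    have hPd := (hP.differentiable (by simp) (h + t • e)).hasFDerivAt
    have hline : HasDerivAt (fun s : ℂ => h + s • e) e t := by
      simpa using ((hasDerivAt_id t).smul_const e).const_add h
    exact (hPd.comp_hasDerivAt t hline).deriv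
  have hv : ∀ k : ℕ, iteratedFDeriv ℂ k P h (fun _ => e) = iteratedDeriv k f 0 := by
    intro k
    simpa using (iteratedDeriv_comp_add_smul (hPk k) h e (0 : ℂ)).symm
  have heigen : ∀ k : ℕ, lie h (iteratedDeriv k f 0) = (2 * k : ℂ) • iteratedDeriv k f 0 := by
    intro k
    simpa using map_iteratedDeriv_eq_of_euler hf (lie h).toContinuousLinearMap 2
      (fun t => by
        rw [hderiv]
        simp only [LinearMap.coe_toContinuousLinearMap', hf_def, ← hPeq, map_add, map_smul,
          lie_self, hhe, zero_add]
        module) k 0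
  have hstep : ∀ k : ℕ, lie e (iteratedDeriv k f 0) = (-2 : ℂ) • iteratedDeriv (k + 1) f 0 := by
    intro k
    simpa using map_iteratedDeriv_eq_smul_succ hf (lie e).toContinuousLinearMap (-2)
      (fun t => by
        rw [hderiv]
        simp only [LinearMap.coe_toContinuousLinearMap', hf_def, ← hPeq, map_add, map_smul,
          lie_self, hskew e h, hhe, smul_zero, add_zero, map_neg]
        module) k 0
  have htop : iteratedDeriv m f 0 ≠ 0 := by
    rw [← hv, iteratedFDeriv_apply_const_of_homogeneous (hPk m) hhom]
    exact smul_ne_zero (Nat.cast_ne_zero.mpr m.factorial_ne_zero) hne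
  have hnonzero : ∀ k ≤ m, iteratedDeriv k f 0 ≠ 0 := by
    intro k hk
    induction hk using Nat.decreasingInduction with
    | self => exact htop
    | of_succ k _ ih =>
      intro hzero
      have hs := hstep k
      rw [hzero, map_zero] at hs
      exact smul_ne_zero (by norm_num) ih hs.symm
  simp only [hv]
  refine Module.End.eigenvectors_linearIndependent' (lie h)
    (fun k : Fin (m + 1) => (2 * (k : ℕ) : ℂ)) ?_ _ fun k => ?_
  · intro i j hij
    simpa [Fin.ext_iff] using hij
  · exact Module.End.hasEigenvector_iff.mpr
      ⟨Module.End.mem_eigenspace_iff.mpr (heigen k), hnonzero k (Nat.lt_succ_iff.mp k.2)⟩
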